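/- arXiv:1803.06922 — 2 statements merged into one kernel-verified Lean document; each statement's English description precedes it below -/
import Mathlib

section
/- Let X be a centered d-dimensional Gaussian random vector with non-singular covariance matrix \Sigma and let c \in R^d have at least one positive component, with I the index set determined by \Pi_\Sigma(c). Then for every fixed x \in R^d, P(X_I > c_I u + x_I/u) \sim P(X_I > c_I u) \, e^{- x_I^T (\Sigma_{II})^{-1} c_I} as u \to \infty. -/
open MeasureTheory ProbabilityTheory Filter Matrix
open scoped Topology ENNReal

noncomputable section

/-- Submatrix of `A` keeping rows with indices in `I` and columns with indices in `J`. -/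
def subM {ι : Type*} (A : Matrix ι ι ℝ) (I J : Finset ι) : Matrix ↥I ↥J ℝ :=
  fun i j => A i j

/-- Subvector of `c` keeping the entries with indices in `I`. -/
def subV {ι : Type*} (c : ι → ℝ) (I : Finset ι) : ↥I → ℝ := fun i => c i

/-- Density of a centered Gaussian vector with covariance matrix `S`. -/
def gaussPDF {ι : Type*} [Fintype ι] [DecidableEq ι] (S : Matrix ι ι ℝ) (x : ι → ℝ) : ℝ :=
  (Real.sqrt ((2 * Real.pi) ^ Fintype.card ι * S.det))⁻¹ *
    Real.exp (-(x ⬝ᵥ S⁻¹.mulVec x) / 2)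

/-- `X` is, under `P`, a centered Gaussian random vector with covariance matrix `S`. -/
def IsCenteredGaussianRV {Ω ι : Type*} [MeasurableSpace Ω] [Fintype ι] [DecidableEq ι]
    (P : Measure Ω) (X : Ω → ι → ℝ) (S : Matrix ι ι ℝ) : Prop :=
  Measure.map X P =
    (volume : Measure (ι → ℝ)).withDensity fun x => ENNReal.ofReal (gaussPDF S x)

/-- `bt` is a solution of the quadratic programming problem `Π_A(c)`:
minimise `x ⬝ Σ⁻¹ x` under `x ≥ c`. -/
def IsQPSol {ι : Type*} [Fintype ι] [DecidableEq ι] (A : Matrix ι ι ℝ) (c bt : ι → ℝ) : Prop :=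
  (∀ i, c i ≤ bt i) ∧
    ∀ x : ι → ℝ, (∀ i, c i ≤ x i) → bt ⬝ᵥ A⁻¹.mulVec bt ≤ x ⬝ᵥ A⁻¹.mulVec x

/-- `I` is the index set determined by the quadratic programming problem `Π_A(c)`
with solution `bt`. -/
def IsQPIndex {ι : Type*} [Fintype ι] [DecidableEq ι] (A : Matrix ι ι ℝ)
    (c bt : ι → ℝ) (I : Finset ι) : Prop :=
  I.Nonempty ∧ (∀ i ∈ I, bt i = c i) ∧
    (∀ i : ↥I, 0 < (subM A I I)⁻¹.mulVec (subV c I) i) ∧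
    ∀ j : ι, j ∉ I → bt j = (fun i : ↥I => A j i) ⬝ᵥ (subM A I I)⁻¹.mulVec (subV c I)

/-- `Σ_{i₀,I} (Σ_{II})⁻¹ c_I`. -/
def rowDot {ι : Type*} [Fintype ι] [DecidableEq ι] (A : Matrix ι ι ℝ) (c : ι → ℝ)
    (I : Finset ι) (i0 : ι) : ℝ :=
  (fun i : ↥I => A i0 i) ⬝ᵥ (subM A I I)⁻¹.mulVec (subV c I)

/-- `c_I ⬝ (Σ_{II})⁻¹ e_{i₀}`. -/
def eDot {ι : Type*} [Fintype ι] [DecidableEq ι] (A : Matrix ι ι ℝ) (c : ι → ℝ)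
    (I : Finset ι) (i0 : ι) : ℝ :=
  subV c I ⬝ᵥ (subM A I I)⁻¹.mulVec fun j : ↥I => if (j : ι) = i0 then 1 else 0

/-- Schur complement `Σ_{I^cI^c} - Σ_{I^cI}(Σ_{II})⁻¹Σ_{II^c}`, the covariance matrix of the
conditional Gaussian distribution of `X_{I^c}` given `X_I`. -/
def schurC {ι : Type*} [Fintype ι] [DecidableEq ι] (A : Matrix ι ι ℝ) (I : Finset ι) :
    Matrix ↥Iᶜ ↥Iᶜ ℝ :=
  subM A Iᶜ Iᶜ - subM A Iᶜ I * (subM A I I)⁻¹ * subM A I Iᶜ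

/-- The conditional law of `X_{I^c}` given `X_I = 0`. -/
def condNu {ι : Type*} [Fintype ι] [DecidableEq ι] (A : Matrix ι ι ℝ) (I : Finset ι) :
    Measure (↥Iᶜ → ℝ) :=
  (volume : Measure (↥Iᶜ → ℝ)).withDensity fun y => ENNReal.ofReal (gaussPDF (schurC A I) y)

/-- Survival function `Ḡ(x) = P(X_{i₀} > x, X_{N*} > 0 | X_I = 0) / P(X_{N*} > 0 | X_I = 0)`. -/
def Gbar {ι : Type*} [Fintype ι] [DecidableEq ι] (A : Matrix ι ι ℝ) (I Nstar : Finset ι)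
    (i0 : ι) (x : ℝ) : ℝ :=
  (condNu A I {y : ↥Iᶜ → ℝ | (∀ j : ↥Iᶜ, (j : ι) = i0 → x < y j) ∧
      ∀ j : ↥Iᶜ, (j : ι) ∈ Nstar → 0 < y j}).toReal /
    (condNu A I {y : ↥Iᶜ → ℝ | ∀ j : ↥Iᶜ, (j : ι) ∈ Nstar → 0 < y j}).toReal

/-- `E[(Y - μ)₊]` where `Y` has survival function `Gbar A I Nstar i0`. -/
def condPlusMean {ι : Type*} [Fintype ι] [DecidableEq ι] (A : Matrix ι ι ℝ)
    (I Nstar : Finset ι) (i0 : ι) (μ : ℝ) : ℝ :=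
  (∫ y in {y : ↥Iᶜ → ℝ | ∀ j : ↥Iᶜ, (j : ι) ∈ Nstar → 0 < y j},
      max ((∑ j : ↥Iᶜ, if (j : ι) = i0 then y j else 0) - μ) 0 ∂(condNu A I)) /
    (condNu A I {y : ↥Iᶜ → ℝ | ∀ j : ↥Iᶜ, (j : ι) ∈ Nstar → 0 < y j}).toReal

/-- `E[Y]` where `Y` has survival function `Gbar A I Nstar i0`. -/
def condMean {ι : Type*} [Fintype ι] [DecidableEq ι] (A : Matrix ι ι ℝ)
    (I Nstar : Finset ι) (i0 : ι) : ℝ :=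
  (∫ y in {y : ↥Iᶜ → ℝ | ∀ j : ↥Iᶜ, (j : ι) ∈ Nstar → 0 < y j},
      (∑ j : ↥Iᶜ, if (j : ι) = i0 then y j else 0) ∂(condNu A I)) /
    (condNu A I {y : ↥Iᶜ → ℝ | ∀ j : ↥Iᶜ, (j : ι) ∈ Nstar → 0 < y j}).toReal

/-- The conditioning event `{X_2 > c_2 u, ..., X_d > c_d u}`. -/
def tailEvent {Ω : Type*} {d : ℕ} [NeZero d] (X : Ω → Fin d → ℝ) (c : Fin d → ℝ) (u : ℝ) :
    Set Ω := {ω | ∀ i : Fin d, i ≠ 0 → c i * u < X ω i}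

/-- The marginal mean excess `E(c,u) = E[(X_1 - c_1 u - μ)₊ | X_2 > c_2 u, ..., X_d > c_d u]`. -/
def mmeV {Ω : Type*} [MeasurableSpace Ω] {d : ℕ} [NeZero d] (P : Measure Ω)
    (X : Ω → Fin d → ℝ) (c : Fin d → ℝ) (μ u : ℝ) : ℝ :=
  (∫ ω in tailEvent X c u, max (X ω 0 - c 0 * u - μ) 0 ∂P) / (P (tailEvent X c u)).toReal

/-- The marginal expected shortfall `S(c,u) = E[X_1 | X_2 > c_2 u, ..., X_d > c_d u]`. -/
def mesV {Ω : Type*} [MeasurableSpace Ω] {d : ℕ} [NeZero d] (P : Measure Ω)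
    (X : Ω → Fin d → ℝ) (c : Fin d → ℝ) (u : ℝ) : ℝ :=
  (∫ ω in tailEvent X c u, X ω 0 ∂P) / (P (tailEvent X c u)).toReal

/-- The multivariate conditional tail expectation `M(c,u) = E[X_1 | X > c u]`. -/
def mcteV {Ω : Type*} [MeasurableSpace Ω] {d : ℕ} [NeZero d] (P : Measure Ω)
    (X : Ω → Fin d → ℝ) (c : Fin d → ℝ) (u : ℝ) : ℝ :=
  (∫ ω in {ω | ∀ i, c i * u < X ω i}, X ω 0 ∂P) / (P {ω | ∀ i, c i * u < X ω i}).toReal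

/-- The index set `{2,...,d}` of the components of `X_{-1}`. -/
def offFirst (d : ℕ) [NeZero d] : Finset (Fin d) := Finset.univ.filter fun i => i ≠ 0

lemma aux_int {α : Type*} [MeasurableSpace α] (μ : Measure α) [IsFiniteMeasure μ]
    (s : α → ℝ) (hs : Measurable s) (h0 : ∀ᵐ a ∂μ, 0 ≤ s a) :
    Integrable (fun a => Real.exp (-(s a))) μ := by
  refine Integrable.of_bound (C := 1) (by fun_prop) ?_
  filter_upwards [h0] with a ha
  rw [Real.norm_eq_abs, Real.abs_exp]
  exact Real.exp_le_one_iff.2 (by linarith)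

lemma aux_pos {α : Type*} [MeasurableSpace α] (μ : Measure α) [IsFiniteMeasure μ] [NeZero μ]
    (s : α → ℝ) (hs : Measurable s) (h0 : ∀ᵐ a ∂μ, 0 ≤ s a) :
    0 < ∫ a, Real.exp (-(s a)) ∂μ := integral_exp_pos (aux_int μ s hs h0)

lemma aux_cheb {α : Type*} [MeasurableSpace α] (μ : Measure α) [IsFiniteMeasure μ] [NeZero μ]
    (s : α → ℝ) (hs : Measurable s) (h0 : ∀ᵐ a ∂μ, 0 ≤ s a) (t h : ℝ) (ht : 0 ≤ t) (hh : 0 ≤ h) :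
    (∫ a, Real.exp (-(t * s a)) ∂μ) * (∫ a, Real.exp (-(h * s a)) ∂μ) ≤
      (∫ a, Real.exp (-((t + h) * s a)) ∂μ) * μ.real Set.univ := by
  have hM : 0 < μ.real Set.univ := by
    rw [measureReal_def]
    exact ENNReal.toReal_pos (by simpa using NeZero.ne μ) (measure_ne_top _ _)
  rcases hh.eq_or_lt with rfl | hh'
  · simp
  have hI : ∀ t : ℝ, 0 ≤ t → Integrable (fun a => Real.exp (-(t * s a))) μ := fun t ht =>
    aux_int μ (fun a => t * s a) (by fun_prop) (by filter_upwards [h0] with a ha; positivity)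
  have hFh : 0 < ∫ a, Real.exp (-(h * s a)) ∂μ := integral_exp_pos (hI h hh)
  set M := μ.real Set.univ with hMdef
  set Fh := ∫ a, Real.exp (-(h * s a)) ∂μ with hFhdef
  obtain ⟨s0, hs0⟩ : ∃ s0 : ℝ, Real.exp (-(h * s0)) = Fh / M := by
    refine ⟨-Real.log (Fh / M) / h, ?_⟩
    rw [show -(h * (-Real.log (Fh / M) / h)) = Real.log (Fh / M) by field_simp]
    exact Real.exp_log (by positivity)
  set k := Real.exp (-(t * s0))
  have key : 0 ≤ ∫ a, (Real.exp (-(t * s a)) - k) * (Real.exp (-(h * s a)) - Fh / M) ∂μ := by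
    refine integral_nonneg fun a => ?_
    rw [← hs0]
    rcases le_total (s a) s0 with hle | hle
    · exact mul_nonneg (sub_nonneg.2 (Real.exp_le_exp.2 (by nlinarith)))
        (sub_nonneg.2 (Real.exp_le_exp.2 (by nlinarith)))
    · exact mul_nonneg_of_nonpos_of_nonpos (sub_nonpos.2 (Real.exp_le_exp.2 (by nlinarith)))
        (sub_nonpos.2 (Real.exp_le_exp.2 (by nlinarith)))
  have e : (fun a => (Real.exp (-(t * s a)) - k) * (Real.exp (-(h * s a)) - Fh / M)) =
      fun a => Real.exp (-((t + h) * s a)) - (Fh / M) * Real.exp (-(t * s a))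
        - (k * Real.exp (-(h * s a)) - k * (Fh / M)) := by
    funext a
    rw [show -((t + h) * s a) = -(t * s a) + -(h * s a) by ring, Real.exp_add]
    ring
  have j1 : Integrable (fun a => Real.exp (-((t + h) * s a))) μ := hI _ (by positivity)
  have j2 : Integrable (fun a => (Fh / M) * Real.exp (-(t * s a))) μ := (hI t ht).const_mul _
  have j3 : Integrable (fun a => k * Real.exp (-(h * s a))) μ := (hI h hh).const_mul _
  have j4 : Integrable (fun _ : α => k * (Fh / M)) μ := integrable_const _
  have j5 : Integrable (fun a => Real.exp (-((t + h) * s a)) -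
    (Fh / M) * Real.exp (-(t * s a))) μ := j1.sub j2
  have j6 : Integrable (fun a => k * Real.exp (-(h * s a)) - k * (Fh / M)) μ := j3.sub j4
  rw [e, integral_sub j5 j6, integral_sub j1 j2, integral_sub j3 j4,
    integral_const_mul, integral_const_mul, integral_const, ← hFhdef, ← hMdef, smul_eq_mul,
    show M * (k * (Fh / M)) = k * Fh by field_simp, sub_self, sub_zero, sub_nonneg,
    div_mul_eq_mul_div, div_le_iff₀ hM] at key
  linarith

lemma aux_ratio {α : Type*} [MeasurableSpace α] (μ : Measure α) [IsFiniteMeasure μ] [NeZero μ]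
    (s r : α → ℝ) (hs : Measurable s) (hr : Measurable r) (h0 : ∀ᵐ a ∂μ, 0 ≤ s a) (K : ℝ)
    (hK : 0 ≤ K) (hrs : ∀ᵐ a ∂μ, |r a| ≤ K * s a) :
    Tendsto (fun u : ℝ => (∫ a, Real.exp (-(u * s a + r a / u)) ∂μ) /
      (∫ a, Real.exp (-(u * s a)) ∂μ)) atTop (𝓝 1) := by
  have hM : 0 < μ.real Set.univ := by
    rw [measureReal_def]
    exact ENNReal.toReal_pos (by simpa using NeZero.ne μ) (measure_ne_top _ _)
  set M := μ.real Set.univ with hMdef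
  have hI : ∀ t : ℝ, 0 ≤ t → Integrable (fun a => Real.exp (-(t * s a))) μ := fun t ht =>
    aux_int μ (fun a => t * s a) (by fun_prop) (by filter_upwards [h0] with a ha; positivity)
  have hKu : Tendsto (fun u : ℝ => K / u) atTop (𝓝 0) := tendsto_const_nhds.div_atTop tendsto_id
  have hlim : Tendsto (fun u : ℝ => ∫ a, Real.exp (-(K / u * s a)) ∂μ) atTop (𝓝 M) := by
    have : M = ∫ a, (1 : ℝ) ∂μ := by simp [hMdef]
    rw [this]
    refine tendsto_integral_filter_of_dominated_convergence (fun _ => 1)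
      (Eventually.of_forall fun u => by fun_prop) ?_ (integrable_const _) ?_
    · filter_upwards [eventually_gt_atTop 0] with u hu
      filter_upwards [h0] with a ha
      rw [Real.norm_eq_abs, Real.abs_exp]
      have : 0 ≤ K / u * s a := by positivity
      exact Real.exp_le_one_iff.2 (by linarith)
    · refine Eventually.of_forall fun a => ?_
      have := (Real.continuous_exp.tendsto _).comp ((hKu.mul_const (s a)).neg)
      simpa [Function.comp_def] using this
  have hlo : Tendsto (fun u : ℝ => (∫ a, Real.exp (-(K / u * s a)) ∂μ) / M) atTop (𝓝 1) := by
    have := hlim.div_const M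
    rwa [div_self hM.ne'] at this
  have hhi : Tendsto (fun u : ℝ => M / (∫ a, Real.exp (-(K / u * s a)) ∂μ)) atTop (𝓝 1) := by
    have := (tendsto_const_nhds (x := M)).div hlim hM.ne'
    rwa [div_self hM.ne'] at this
  have hev : ∀ᶠ u : ℝ in atTop, 0 < u ∧ K / u ≤ u := by
    filter_upwards [eventually_gt_atTop 0, hKu.eventually_lt_const one_pos,
      eventually_ge_atTop 1] with u h1 h2 h3
    exact ⟨h1, by linarith⟩
  have hrb : ∀ u : ℝ, 0 < u → ∀ᵐ a ∂μ, (u - K / u) * s a ≤ u * s a + r a / u ∧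
      u * s a + r a / u ≤ (u + K / u) * s a := by
    intro u hu
    filter_upwards [hrs] with a ha
    have h1 := div_le_div_of_nonneg_right (abs_le.1 ha).1 hu.le
    have h2 := div_le_div_of_nonneg_right (abs_le.1 ha).2 hu.le
    rw [neg_div, mul_div_right_comm] at h1
    rw [mul_div_right_comm] at h2
    constructor <;> linarith
  have hG : ∀ u : ℝ, 0 < u → K / u ≤ u →
      Integrable (fun a => Real.exp (-(u * s a + r a / u))) μ := by
    intro u hu hk
    refine aux_int μ (fun a => u * s a + r a / u) (by fun_prop) ?_
    filter_upwards [h0, hrb u hu] with a ha hb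
    exact le_trans (mul_nonneg (by linarith) ha) hb.1
  refine tendsto_of_tendsto_of_tendsto_of_le_of_le' hlo hhi ?_ ?_
  · filter_upwards [hev] with u ⟨hu, hk⟩
    have hF : 0 < ∫ a, Real.exp (-(u * s a)) ∂μ := integral_exp_pos (hI u hu.le)
    have hc := aux_cheb μ s hs h0 u (K / u) hu.le (by positivity)
    have hm : (∫ a, Real.exp (-((u + K / u) * s a)) ∂μ) ≤
        ∫ a, Real.exp (-(u * s a + r a / u)) ∂μ := by
      refine integral_mono_ae (hI _ (by positivity)) (hG u hu hk) ?_
      filter_upwards [hrb u hu] with a hb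
      exact Real.exp_le_exp.2 (by linarith [hb.2])
    rw [div_le_div_iff₀ hM hF]
    nlinarith [mul_le_mul_of_nonneg_right hm hM.le]
  · filter_upwards [hev] with u ⟨hu, hk⟩
    have hF : 0 < ∫ a, Real.exp (-(u * s a)) ∂μ := integral_exp_pos (hI u hu.le)
    have hF' : 0 < ∫ a, Real.exp (-(K / u * s a)) ∂μ := integral_exp_pos (hI _ (by positivity))
    have hc := aux_cheb μ s hs h0 (u - K / u) (K / u) (by linarith) (by positivity)
    rw [sub_add_cancel] at hc
    have hm : (∫ a, Real.exp (-(u * s a + r a / u)) ∂μ) ≤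
        ∫ a, Real.exp (-((u - K / u) * s a)) ∂μ := by
      refine integral_mono_ae (hG u hu hk) (hI _ (by linarith)) ?_
      filter_upwards [hrb u hu] with a hb
      exact Real.exp_le_exp.2 (by linarith [hb.1])
    rw [div_le_div_iff₀ hF hF']
    nlinarith [mul_le_mul_of_nonneg_right hm hF'.le]

lemma aux_shift {d : ℕ} (A : Matrix (Fin d) (Fin d) ℝ) (hA : A.PosDef)
    (ν : Measure (Fin d → ℝ))
    (hν : ν = (volume : Measure (Fin d → ℝ)).withDensity fun x => ENNReal.ofReal (gaussPDF A x))
    (I : Finset (Fin d)) (q : Fin d → ℝ) :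
    (ν {z | ∀ i ∈ I, (A *ᵥ q) i < z i}).toReal =
      Real.exp (-(q ⬝ᵥ A *ᵥ q) / 2) *
        ∫ z in {z : Fin d → ℝ | ∀ i ∈ I, 0 < z i}, Real.exp (-(q ⬝ᵥ z)) ∂ν := by
  have hc : Continuous (gaussPDF A) := by
    unfold gaussPDF
    fun_prop
  have hm : Measurable (gaussPDF A) := hc.measurable
  have hnn : ∀ x, 0 ≤ gaussPDF A x := fun x => by unfold gaussPDF; positivity
  have hS : ∀ a : Fin d → ℝ, MeasurableSet {z : Fin d → ℝ | ∀ i ∈ I, a i < z i} := by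
    intro a
    have : {z : Fin d → ℝ | ∀ i ∈ I, a i < z i} = ⋂ i ∈ I, {z | a i < z i} := by
      ext; simp
    rw [this]
    exact Finset.measurableSet_biInter _ fun i _ =>
      measurableSet_lt measurable_const (measurable_pi_apply i)
  have hS0 := hS 0
  simp only [Pi.zero_apply] at hS0
  have hsym : Aᵀ = A := by simpa using hA.1.eq
  have hisym : (A⁻¹)ᵀ = A⁻¹ := by rw [Matrix.transpose_nonsing_inv, hsym]
  have hdet : IsUnit A.det := hA.det_pos.ne'.isUnit
  have hshift : ∀ z, gaussPDF A (z + A *ᵥ q) =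
      gaussPDF A z * (Real.exp (-(q ⬝ᵥ A *ᵥ q) / 2) * Real.exp (-(q ⬝ᵥ z))) := by
    intro z
    have h1 : A⁻¹ *ᵥ (A *ᵥ q) = q := by
      rw [Matrix.mulVec_mulVec, Matrix.nonsing_inv_mul _ hdet, Matrix.one_mulVec]
    have h2 : (A *ᵥ q) ⬝ᵥ A⁻¹ *ᵥ z = q ⬝ᵥ z := by
      rw [Matrix.dotProduct_mulVec, ← Matrix.mulVec_transpose, hisym, h1]
    unfold gaussPDF
    rw [mul_assoc, ← Real.exp_add, ← Real.exp_add, Matrix.mulVec_add, h1, add_dotProduct,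
      dotProduct_add, dotProduct_add, h2, dotProduct_comm z q, dotProduct_comm (A *ᵥ q) q]
    congr 2
    ring
  have e1 : (ν {z | ∀ i ∈ I, (A *ᵥ q) i < z i}).toReal =
      ∫ z, Set.indicator {z | ∀ i ∈ I, (A *ᵥ q) i < z i} (gaussPDF A) z := by
    rw [integral_indicator (hS _), hν, withDensity_apply _ (hS _),
      integral_eq_lintegral_of_nonneg_ae (Eventually.of_forall hnn) hm.aestronglyMeasurable]
  rw [e1, ← integral_add_right_eq_self _ (A *ᵥ q), ← integral_const_mul, hν,
    setIntegral_withDensity_eq_setIntegral_toReal_smul (by fun_prop) (by simp) _ hS0,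
    ← integral_indicator hS0]
  refine integral_congr_ae (Eventually.of_forall fun z => ?_)
  simp only [Set.indicator, Set.mem_ofPred_eq, Pi.add_apply, lt_add_iff_pos_left, hshift,
    smul_eq_mul, ENNReal.toReal_ofReal (hnn _)]

lemma aux_dot {d : ℕ} (I : Finset (Fin d)) (a : Fin d → ℝ) (p : ↥I → ℝ) :
    (fun j => if h : j ∈ I then p ⟨j, h⟩ else 0) ⬝ᵥ a = subV a I ⬝ᵥ p := by
  classical
  simp only [dotProduct, subV]
  rw [← Finset.sum_subset (Finset.subset_univ I) (by intro j _ hj; simp [hj]),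
    ← Finset.sum_coe_sort]
  exact Finset.sum_congr rfl fun i _ => by simp [mul_comm]

/-- Remark after Lemma 4.2: with `I` the index set of `Π_Σ(c)`, for every fixed `x ∈ ℝ^d`,
`P(X_I > c_I u + x_I/u) ~ P(X_I > c_I u) e^{-x_I^⊤(Σ_II)⁻¹c_I}` as `u → ∞`. -/
theorem gaussian_tail_perturbation
    {Ω : Type*} [MeasurableSpace Ω] (P : Measure Ω) [IsProbabilityMeasure P]
    {d : ℕ} (A : Matrix (Fin d) (Fin d) ℝ) (hA : A.PosDef)
    (X : Ω → Fin d → ℝ) (hX : Measurable X) (hG : IsCenteredGaussianRV P X A)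
    (c : Fin d → ℝ) (hc : ∃ i, 0 < c i)
    (bt : Fin d → ℝ) (I : Finset (Fin d))
    (hsol : IsQPSol A c bt) (hI : IsQPIndex A c bt I) :
    ∀ x : Fin d → ℝ,
      Tendsto (fun u =>
          (P {ω | ∀ i ∈ I, c i * u + x i / u < X ω i}).toReal /
            ((P {ω | ∀ i ∈ I, c i * u < X ω i}).toReal *
              Real.exp (-(subV x I ⬝ᵥ (subM A I I)⁻¹.mulVec (subV c I)))))
        atTop (𝓝 1) := by
  intro x
  obtain ⟨hne, -, hwpos, -⟩ := hI
  have hB : (subM A I I).PosDef := by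
    have := hA.submatrix (e := fun i : ↥I => (i : Fin d)) Subtype.val_injective
    exact this
  have hBdet : IsUnit (subM A I I).det := hB.det_pos.ne'.isUnit
  set w' := (subM A I I)⁻¹ *ᵥ subV c I with hw'
  set p' := (subM A I I)⁻¹ *ᵥ subV x I with hp'
  set w : Fin d → ℝ := fun j => if h : j ∈ I then w' ⟨j, h⟩ else 0 with hw
  set p : Fin d → ℝ := fun j => if h : j ∈ I then p' ⟨j, h⟩ else 0 with hp
  have hBw : subM A I I *ᵥ w' = subV c I := by
    rw [hw', Matrix.mulVec_mulVec, Matrix.mul_nonsing_inv _ hBdet, Matrix.one_mulVec]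
  have hBp : subM A I I *ᵥ p' = subV x I := by
    rw [hp', Matrix.mulVec_mulVec, Matrix.mul_nonsing_inv _ hBdet, Matrix.one_mulVec]
  have hAw : ∀ i ∈ I, (A *ᵥ w) i = c i := by
    intro i hi
    have : (A *ᵥ w) i = (subM A I I *ᵥ w') ⟨i, hi⟩ := by
      change A i ⬝ᵥ w = _
      rw [dotProduct_comm, hw, aux_dot]
      rfl
    rw [this, hBw]; rfl
  have hAp : ∀ i ∈ I, (A *ᵥ p) i = x i := by
    intro i hi
    have : (A *ᵥ p) i = (subM A I I *ᵥ p') ⟨i, hi⟩ := by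
      change A i ⬝ᵥ p = _
      rw [dotProduct_comm, hp, aux_dot]
      rfl
    rw [this, hBp]; rfl
  have hwAp : w ⬝ᵥ A *ᵥ p = subV x I ⬝ᵥ w' := by
    rw [hw, aux_dot]
    congr 1
    funext i
    exact hAp i i.2
  have hsym : Aᵀ = A := by simpa using hA.1.eq
  have hpAw : p ⬝ᵥ A *ᵥ w = subV x I ⬝ᵥ w' := by
    rw [Matrix.dotProduct_mulVec, ← Matrix.mulVec_transpose, hsym, dotProduct_comm, hwAp]
  have hwp : ∀ i ∈ I, 0 < w i := by
    intro i hi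
    simp only [hw, hi, dif_pos]
    exact hwpos ⟨i, hi⟩
  set ν := Measure.map X P with hνdef
  have hν : ν = (volume : Measure (Fin d → ℝ)).withDensity
    fun x => ENNReal.ofReal (gaussPDF A x) := hG
  have : IsProbabilityMeasure ν := Measure.isProbabilityMeasure_map hX.aemeasurable
  set S : Set (Fin d → ℝ) := {z | ∀ i ∈ I, 0 < z i} with hSdef
  have hSeq : ∀ a : Fin d → ℝ, {z : Fin d → ℝ | ∀ i ∈ I, a i < z i} = ⋂ i ∈ I, {z | a i < z i} := by
    intro a; ext; simp
  have hSm : ∀ a : Fin d → ℝ, MeasurableSet {z : Fin d → ℝ | ∀ i ∈ I, a i < z i} := by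
    intro a
    rw [hSeq]
    exact Finset.measurableSet_biInter _ fun i _ =>
      measurableSet_lt measurable_const (measurable_pi_apply i)
  have hSo : IsOpen S := by
    have h := hSeq 0
    simp only [Pi.zero_apply] at h
    rw [hSdef, h]
    exact isOpen_biInter_finset fun i _ => isOpen_lt continuous_const (continuous_apply i)
  have hSms : MeasurableSet S := hSo.measurableSet
  have hSpos : ν S ≠ 0 := by
    have hc : Continuous (gaussPDF A) := by
      unfold gaussPDF
      fun_prop
    have hpos : ∀ z, 0 < gaussPDF A z := fun z => by
      have := hA.det_pos
      unfold gaussPDF; positivity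
    rw [hν, Ne, withDensity_apply_eq_zero (by fun_prop)]
    have : {z | ENNReal.ofReal (gaussPDF A z) ≠ 0} ∩ S = S := by
      ext z; simp [hpos z]
    rw [this]
    exact (hSo.measure_pos volume ⟨fun _ => 1, fun i _ => one_pos⟩).ne'
  have : NeZero (ν.restrict S) := ⟨by rwa [Ne, Measure.restrict_eq_zero]⟩
  have hsh := aux_shift A hA ν hν I
  obtain ⟨K, hK0, hK⟩ : ∃ K : ℝ, 0 ≤ K ∧ ∀ i, |p i| ≤ K * w i := by
    refine ⟨∑ i ∈ I, |p i| / w i, Finset.sum_nonneg fun i hi =>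
      div_nonneg (abs_nonneg _) (hwp i hi).le, fun i => ?_⟩
    by_cases hi : i ∈ I
    · rw [← div_le_iff₀ (hwp i hi)]
      exact Finset.single_le_sum (f := fun i => |p i| / w i)
        (fun j hj => div_nonneg (abs_nonneg _) (hwp j hj).le) hi
    · simp [hw, hp, hi]
  have hr := aux_ratio (ν.restrict S) (fun z => w ⬝ᵥ z) (fun z => p ⬝ᵥ z)
    (by unfold dotProduct; fun_prop) (by unfold dotProduct; fun_prop)
    (by
      filter_upwards [ae_restrict_mem hSms] with z hz
      refine Finset.sum_nonneg fun i _ => ?_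
      by_cases hi : i ∈ I
      · exact mul_nonneg (hwp i hi).le (hz i hi).le
      · simp [hw, hi]) K hK0
    (by
      filter_upwards [ae_restrict_mem hSms] with z hz
      simp only [dotProduct]
      rw [Finset.mul_sum]
      refine (Finset.abs_sum_le_sum_abs _ _).trans (Finset.sum_le_sum fun i _ => ?_)
      by_cases hi : i ∈ I
      · rw [abs_mul, abs_of_pos (hz i hi), ← mul_assoc]
        exact mul_le_mul_of_nonneg_right (hK i) (hz i hi).le
      · simp [hw, hp, hi])
  have hγ : Tendsto (fun u : ℝ => Real.exp (-(p ⬝ᵥ A *ᵥ p) / 2 / u ^ 2)) atTop (𝓝 1) := by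
    have h1 : Tendsto (fun u : ℝ => -(p ⬝ᵥ A *ᵥ p) / 2 / u ^ 2) atTop (𝓝 0) :=
      tendsto_const_nhds.div_atTop (tendsto_pow_atTop two_ne_zero)
    simpa [Function.comp_def] using (Real.continuous_exp.tendsto _).comp h1
  have hfin := hγ.mul hr
  rw [one_mul] at hfin
  refine hfin.congr' ?_
  filter_upwards [eventually_gt_atTop 0] with u hu
  have hPν : ∀ a : Fin d → ℝ, P {ω | ∀ i ∈ I, a i < X ω i} = ν {z | ∀ i ∈ I, a i < z i} := by
    intro a
    rw [hνdef, Measure.map_apply hX (hSm a)]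
    rfl
  have n1 := hsh (u • w + u⁻¹ • p)
  have n2 := hsh (u • w)
  have s1 : {z : Fin d → ℝ | ∀ i ∈ I, (A *ᵥ (u • w + u⁻¹ • p)) i < z i} =
      {z | ∀ i ∈ I, c i * u + x i / u < z i} := by
    ext z
    refine forall₂_congr fun i hi => ?_
    rw [Matrix.mulVec_add, Matrix.mulVec_smul, Matrix.mulVec_smul]
    simp only [Pi.add_apply, Pi.smul_apply, smul_eq_mul, hAw i hi, hAp i hi]
    rw [mul_comm u, mul_comm u⁻¹, div_eq_mul_inv]
  have s2 : {z : Fin d → ℝ | ∀ i ∈ I, (A *ᵥ (u • w)) i < z i} =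
      {z | ∀ i ∈ I, c i * u < z i} := by
    ext z
    refine forall₂_congr fun i hi => ?_
    rw [Matrix.mulVec_smul]
    simp only [Pi.smul_apply, smul_eq_mul, hAw i hi]
    rw [mul_comm u]
  have q1 : (u • w + u⁻¹ • p) ⬝ᵥ A *ᵥ (u • w + u⁻¹ • p) =
      u ^ 2 * (w ⬝ᵥ A *ᵥ w) + 2 * (subV x I ⬝ᵥ w') + (p ⬝ᵥ A *ᵥ p) / u ^ 2 := by
    simp only [Matrix.mulVec_add, Matrix.mulVec_smul, add_dotProduct, dotProduct_add,
      smul_dotProduct, dotProduct_smul, smul_eq_mul, hwAp, hpAw]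
    field_simp
    ring
  have q2 : (u • w) ⬝ᵥ A *ᵥ (u • w) = u ^ 2 * (w ⬝ᵥ A *ᵥ w) := by
    simp only [Matrix.mulVec_smul, smul_dotProduct, dotProduct_smul, smul_eq_mul]
    ring
  have i1 : ∀ z : Fin d → ℝ, (u • w + u⁻¹ • p) ⬝ᵥ z = u * (w ⬝ᵥ z) + (p ⬝ᵥ z) / u := by
    intro z
    simp only [add_dotProduct, smul_dotProduct, smul_eq_mul]
    rw [div_eq_inv_mul]
  have i2 : ∀ z : Fin d → ℝ, (u • w) ⬝ᵥ z = u * (w ⬝ᵥ z) := by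
    intro z
    simp only [smul_dotProduct, smul_eq_mul]
  rw [s1, q1] at n1
  rw [s2, q2] at n2
  simp only [i1] at n1
  simp only [i2] at n2
  rw [hPν (fun i => c i * u + x i / u), hPν (fun i => c i * u), n1, n2]
  rw [show -(u ^ 2 * (w ⬝ᵥ A *ᵥ w) + 2 * (subV x I ⬝ᵥ w') + (p ⬝ᵥ A *ᵥ p) / u ^ 2) / 2 =
    -(p ⬝ᵥ A *ᵥ p) / 2 / u ^ 2 + -(u ^ 2 * (w ⬝ᵥ A *ᵥ w)) / 2 + -(subV x I ⬝ᵥ w') by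
      field_simp
      ring, Real.exp_add, Real.exp_add]
  have e1 := Real.exp_pos (-(u ^ 2 * (w ⬝ᵥ A *ᵥ w)) / 2)
  have e2 := Real.exp_pos (-(subV x I ⬝ᵥ w'))
  generalize Real.exp (-(u ^ 2 * (w ⬝ᵥ A *ᵥ w)) / 2) = E1 at *
  generalize Real.exp (-(subV x I ⬝ᵥ w')) = E2 at *
  rw [← hSdef]
  field_simp
end
end

section
/- Let X be a centered d-dimensional Gaussian random vector with non-singular correlation matrix \Sigma and let c \in R^d have at least one positive component, with I the index set determined by \Pi_\Sigma(c). If 1 \in I, then the multivariate conditional tail expectation satisfies lim_{u \to \infty} u [ M(c,u) - c_1 u ] = 1 / ( c_I^T (\Sigma_{II})^{-1} e_1 ) > 0. -/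
open MeasureTheory ProbabilityTheory Filter Matrix
open scoped Topology ENNReal

noncomputable section

def QF {ι : Type*} [Fintype ι] (B : Matrix ι ι ℝ) (x : ι → ℝ) : ℝ := x ⬝ᵥ B.mulVec x

lemma QF_cont {ι : Type*} [Fintype ι] (B : Matrix ι ι ℝ) : Continuous (QF B) := by
  unfold QF
  exact continuous_id.dotProduct (continuous_const.matrix_mulVec continuous_id)

lemma QF_smul {ι : Type*} [Fintype ι] (B : Matrix ι ι ℝ) (t : ℝ) (x : ι → ℝ) :
    QF B (t • x) = t ^ 2 * QF B x := by
  simp [QF, Matrix.mulVec_smul]; ring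

lemma QF_lower {ι : Type*} [Fintype ι] [DecidableEq ι] [Nonempty ι] (B : Matrix ι ι ℝ)
    (hB : B.PosDef) : ∃ κ : ℝ, 0 < κ ∧ ∀ x : ι → ℝ, κ * ∑ i, x i ^ 2 ≤ QF B x := by
  have hc : IsCompact (Metric.sphere (0 : ι → ℝ) 1) := isCompact_sphere 0 1
  have hne : (Metric.sphere (0 : ι → ℝ) 1).Nonempty := (NormedSpace.sphere_nonempty).2 zero_le_one
  obtain ⟨x0, hx0, hmin⟩ := hc.exists_isMinOn hne (QF_cont B).continuousOn
  have hx0' : x0 ≠ 0 := by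
    rintro rfl; simp at hx0
  have hm : 0 < QF B x0 := by
    have := hB.dotProduct_mulVec_pos hx0'
    simpa [QF] using this
  have hcard : (0 : ℝ) < Fintype.card ι := by exact_mod_cast Fintype.card_pos
  refine ⟨QF B x0 / Fintype.card ι, by positivity, fun x => ?_⟩
  by_cases hx : x = 0
  · subst hx; simp [QF]
  have hn : 0 < ‖x‖ := norm_pos_iff.2 hx
  have h1 : QF B x0 ≤ QF B (‖x‖⁻¹ • x) := hmin (by simp [norm_smul, hn.ne'])
  rw [QF_smul] at h1
  have h2 : ∑ i, x i ^ 2 ≤ Fintype.card ι * ‖x‖ ^ 2 := by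
    calc ∑ i, x i ^ 2 ≤ ∑ i : ι, ‖x‖ ^ 2 := by
          refine Finset.sum_le_sum fun i _ => ?_
          rw [← sq_abs (x i)]
          exact pow_le_pow_left₀ (abs_nonneg _) (norm_le_pi_norm x i) 2
      _ = _ := by simp
  have h3 : QF B x0 * ‖x‖ ^ 2 ≤ QF B x := by
    have := mul_le_mul_of_nonneg_right h1 (sq_nonneg ‖x‖)
    calc _ ≤ _ := this
      _ = _ := by field_simp
  calc _ ≤ QF B x0 / Fintype.card ι * (Fintype.card ι * ‖x‖ ^ 2) := by gcongr
    _ = QF B x0 * ‖x‖ ^ 2 := by field_simp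
    _ ≤ _ := h3

/-- diagonal change of variables -/
lemma cov_diag {ι : Type*} [Fintype ι] [DecidableEq ι] (D : ι → ℝ) (hD : ∀ i, D i ≠ 0)
    (b : ι → ℝ) (h : (ι → ℝ) → ℝ) (hm : Measurable h) :
    ∫ x, h x = |∏ i, D i| * ∫ y : ι → ℝ, h (fun i => b i + D i * y i) := by
  have hdet : Matrix.det (Matrix.diagonal D) ≠ 0 := by
    rw [Matrix.det_diagonal]; exact Finset.prod_ne_zero_iff.2 fun i _ => hD i
  rw [← integral_add_left_eq_self (μ := volume) h b]
  conv_lhs => rw [← Real.smul_map_diagonal_volume_pi hdet]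
  rw [integral_smul_measure, integral_map]
  · simp only [Matrix.det_diagonal, smul_eq_mul, Matrix.toLin'_apply]
    rw [ENNReal.toReal_ofReal (abs_nonneg _)]
    congr 2
    funext y
    congr 1
    ext i
    simp [Matrix.mulVec_diagonal]
  · exact (Continuous.measurable (LinearMap.continuous_on_pi _)).aemeasurable
  · exact (hm.comp (measurable_const_add b)).aestronglyMeasurable

/-- one-dimensional exponential weight -/
def ph (l t : ℝ) : ℝ := if 0 < t then Real.exp (-(l * t)) else 0

lemma ph_eq (l : ℝ) (f : ℝ → ℝ) : (fun t => f t * ph l t) =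
    Set.indicator (Set.Ioi 0) (fun t => f t * Real.exp (-(l * t))) := by
  ext t; by_cases h : 0 < t <;> simp [ph, Set.indicator, h]

lemma ph_int0 {l : ℝ} (hl : 0 < l) : Integrable (fun t => (fun _ => 1) t * ph l t) := by
  rw [ph_eq, integrable_indicator_iff measurableSet_Ioi]
  simpa using! integrableOn_exp_mul_Ioi (a := -l) (by linarith) 0

lemma ph_int1 {l : ℝ} (hl : 0 < l) : Integrable (fun t => (fun t => t) t * ph l t) := by
  rw [ph_eq, integrable_indicator_iff measurableSet_Ioi]
  have := integrableOn_rpow_mul_exp_neg_mul_rpow (p := 1) (s := 1) (b := l) (by norm_num) one_pos hl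
  simpa using! this

lemma ph_val0 {l : ℝ} (hl : 0 < l) : ∫ t, (fun _ => 1) t * ph l t = 1 / l := by
  rw [ph_eq, integral_indicator measurableSet_Ioi]
  have := Real.integral_rpow_mul_exp_neg_mul_Ioi (a := 1) (r := l) one_pos hl
  simpa using! this

lemma ph_val1 {l : ℝ} (hl : 0 < l) : ∫ t, (fun t => t) t * ph l t = (1 / l) * (1 / l) := by
  rw [ph_eq, integral_indicator measurableSet_Ioi]
  have := Real.integral_rpow_mul_exp_neg_mul_Ioi (a := 2) (r := l) two_pos hl
  rw [Real.Gamma_two] at this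
  norm_num at this
  rw [this]; simp; ring


def Dg {ι : Type*} [DecidableEq ι] (I : Finset ι) (u : ℝ) (i : ι) : ℝ := if i ∈ I then u⁻¹ else 1

def Di {ι : Type*} [DecidableEq ι] (I : Finset ι) (i : ι) : ℝ := if i ∈ I then 0 else 1

open Classical in
def KK {ι : Type*} [Fintype ι] (B : Matrix ι ι ℝ) (lam s e : ι → ℝ) (u : ℝ) (y : ι → ℝ) : ℝ :=
  if (∀ i, -(s i) * u < y i) then
    Real.exp (-(∑ i, lam i * y i) - QF B (fun i => e i * y i) / 2) else 0

open Classical in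
def Kinf {ι : Type*} [Fintype ι] (B : Matrix ι ι ℝ) (lam s e : ι → ℝ) (y : ι → ℝ) : ℝ :=
  if (∀ i, s i = 0 → 0 < y i) then
    Real.exp (-(∑ i, lam i * y i) - QF B (fun i => e i * y i) / 2) else 0

def psi {ι : Type*} [DecidableEq ι] (I : Finset ι) (lam : ι → ℝ) (κ : ℝ) (i : ι) (t : ℝ) : ℝ :=
  if i ∈ I then ph (lam i) t else Real.exp (-(κ / 2) * t ^ 2)

lemma psi_nonneg {ι : Type*} [DecidableEq ι] (I : Finset ι) (lam : ι → ℝ) (κ : ℝ) (i : ι) (t : ℝ) :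
    0 ≤ psi I lam κ i t := by
  unfold psi ph; split_ifs <;> positivity

lemma core_bd {ι : Type*} [Fintype ι] [DecidableEq ι] (B : Matrix ι ι ℝ) (I : Finset ι)
    (lam e : ι → ℝ) (κ : ℝ) (hκ : 0 < κ) (hQ : ∀ x : ι → ℝ, κ * ∑ i, x i ^ 2 ≤ QF B x)
    (hl : ∀ i, i ∉ I → lam i = 0) (he : ∀ i, i ∉ I → e i = 1) (y : ι → ℝ)
    (hy : ∀ i ∈ I, 0 < y i) :
    Real.exp (-(∑ i, lam i * y i) - QF B (fun i => e i * y i) / 2) ≤ ∏ i, psi I lam κ i (y i) := by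
  have h : ∏ i, psi I lam κ i (y i) =
      Real.exp (∑ i, (if i ∈ I then -(lam i * y i) else -(κ / 2) * y i ^ 2)) := by
    rw [Real.exp_sum]
    refine Finset.prod_congr rfl fun i _ => ?_
    by_cases hi : i ∈ I
    · simp [psi, ph, hi, hy i hi]
    · simp [psi, hi]
  rw [h, Real.exp_le_exp]
  have h2 := hQ (fun i => e i * y i)
  have h3 : -(∑ i, lam i * y i) - κ / 2 * ∑ i, (e i * y i) ^ 2 ≤
      ∑ i, (if i ∈ I then -(lam i * y i) else -(κ / 2) * y i ^ 2) := by
    rw [Finset.mul_sum, ← Finset.sum_neg_distrib, ← Finset.sum_sub_distrib]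
    refine Finset.sum_le_sum fun i _ => ?_
    by_cases hi : i ∈ I
    · simp only [hi, if_true]
      have : 0 ≤ κ / 2 * (e i * y i) ^ 2 := by positivity
      linarith
    · simp only [hi, if_false, hl i hi, he i hi]
      apply le_of_eq; ring
  linarith

lemma KK_nonneg {ι : Type*} [Fintype ι] (B : Matrix ι ι ℝ) (lam s e : ι → ℝ) (u : ℝ) (y : ι → ℝ) :
    0 ≤ KK B lam s e u y := by unfold KK; split_ifs <;> positivity

lemma Kinf_nonneg {ι : Type*} [Fintype ι] (B : Matrix ι ι ℝ) (lam s e : ι → ℝ) (y : ι → ℝ) :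
    0 ≤ Kinf B lam s e y := by unfold Kinf; split_ifs <;> positivity

lemma KK_le {ι : Type*} [Fintype ι] [DecidableEq ι] (B : Matrix ι ι ℝ) (I : Finset ι)
    (lam s e : ι → ℝ) (κ : ℝ) (hκ : 0 < κ) (hQ : ∀ x : ι → ℝ, κ * ∑ i, x i ^ 2 ≤ QF B x)
    (hl : ∀ i, i ∉ I → lam i = 0) (he : ∀ i, i ∉ I → e i = 1) (hs : ∀ i ∈ I, s i = 0)
    (u : ℝ) (y : ι → ℝ) : KK B lam s e u y ≤ ∏ i, psi I lam κ i (y i) := by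
  unfold KK
  split_ifs with h
  · exact core_bd B I lam e κ hκ hQ hl he y fun i hi => by simpa [hs i hi] using h i
  · exact Finset.prod_nonneg fun i _ => psi_nonneg ..

lemma Kinf_le {ι : Type*} [Fintype ι] [DecidableEq ι] (B : Matrix ι ι ℝ) (I : Finset ι)
    (lam s e : ι → ℝ) (κ : ℝ) (hκ : 0 < κ) (hQ : ∀ x : ι → ℝ, κ * ∑ i, x i ^ 2 ≤ QF B x)
    (hl : ∀ i, i ∉ I → lam i = 0) (he : ∀ i, i ∉ I → e i = 1) (hs : ∀ i ∈ I, s i = 0)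
    (y : ι → ℝ) : Kinf B lam s e y ≤ ∏ i, psi I lam κ i (y i) := by
  unfold Kinf
  split_ifs with h
  · exact core_bd B I lam e κ hκ hQ hl he y fun i hi => h i (hs i hi)
  · exact Finset.prod_nonneg fun i _ => psi_nonneg ..

lemma exp_meas {ι : Type*} [Fintype ι] (B : Matrix ι ι ℝ) (lam e : ι → ℝ) :
    Measurable fun y : ι → ℝ =>
      Real.exp (-(∑ i, lam i * y i) - QF B (fun i => e i * y i) / 2) := by
  apply Continuous.measurable
  have : Continuous fun y : ι → ℝ => QF B (fun i => e i * y i) :=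
    (QF_cont B).comp (by fun_prop)
  fun_prop

lemma KK_meas {ι : Type*} [Fintype ι] (B : Matrix ι ι ℝ) (lam s e : ι → ℝ) (u : ℝ) :
    Measurable (KK B lam s e u) := by
  unfold KK
  refine Measurable.ite ?_ (exp_meas B lam e) measurable_const
  rw [Set.ofPred_forall]
  exact MeasurableSet.iInter fun i => measurableSet_lt measurable_const (measurable_pi_apply i)

lemma Kinf_meas {ι : Type*} [Fintype ι] (B : Matrix ι ι ℝ) (lam s e : ι → ℝ) :
    Measurable (Kinf B lam s e) := by
  unfold Kinf
  refine Measurable.ite ?_ (exp_meas B lam e) measurable_const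
  rw [Set.ofPred_forall]
  refine MeasurableSet.iInter fun i => ?_
  by_cases h : s i = 0
  · simpa [h] using measurableSet_lt measurable_const (measurable_pi_apply i)
  · simp [h]

lemma psi_int {ι : Type*} [DecidableEq ι] (I : Finset ι) (lam : ι → ℝ) (κ : ℝ) (hκ : 0 < κ)
    (hl : ∀ i ∈ I, 0 < lam i) (i : ι) : Integrable (psi I lam κ i) := by
  unfold psi
  by_cases hi : i ∈ I
  · simpa [hi] using ph_int0 (hl i hi)
  · simpa [hi] using integrable_exp_neg_mul_sq (half_pos hκ)

/-- the dominating function is integrable -/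
lemma dom_int {ι : Type*} [Fintype ι] [DecidableEq ι] (I : Finset ι) (lam : ι → ℝ) (κ : ℝ)
    (hκ : 0 < κ) (hl : ∀ i ∈ I, 0 < lam i) (i0 : ι) (hi0 : i0 ∈ I) (f : ℝ → ℝ)
    (hf : Integrable (fun t => f t * ph (lam i0) t)) :
    Integrable (fun y : ι → ℝ => |f (y i0)| * ∏ i, psi I lam κ i (y i)) := by
  have h : Integrable (fun y : ι → ℝ =>
      ∏ i, (fun t => (if i = i0 then |f t| else 1) * psi I lam κ i t) (y i)) := by
    refine Integrable.fintype_prod (f := fun i t => (if i = i0 then |f t| else 1) * psi I lam κ i t)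
      fun i => ?_
    by_cases hi : i = i0
    · subst hi
      have := hf.abs
      refine this.congr (Eventually.of_forall fun t => ?_)
      have : 0 ≤ ph (lam i) t := by unfold ph; split_ifs <;> positivity
      simp [psi, hi0, abs_mul, abs_of_nonneg this]
    · simpa [hi] using psi_int I lam κ hκ hl i
  refine h.congr (Eventually.of_forall fun y => ?_)
  beta_reduce
  rw [Finset.prod_mul_distrib]
  simp

lemma KK_tendsto {ι : Type*} [Fintype ι] [DecidableEq ι] (B : Matrix ι ι ℝ) (I : Finset ι)
    (lam s : ι → ℝ) (hs : ∀ i, 0 ≤ s i) (y : ι → ℝ) :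
    Tendsto (fun u => KK B lam s (Dg I u) u y) atTop (𝓝 (Kinf B lam s (Di I) y)) := by
  have h1 : ∀ᶠ u : ℝ in atTop, ((∀ i, -(s i) * u < y i) ↔ (∀ i, s i = 0 → 0 < y i)) := by
    have : ∀ i, ∀ᶠ u : ℝ in atTop, (-(s i) * u < y i ↔ (s i = 0 → 0 < y i)) := by
      intro i
      by_cases h : s i = 0
      · simp [h]
      · have hp : 0 < s i := lt_of_le_of_ne (hs i) (Ne.symm h)
        filter_upwards [eventually_gt_atTop (-(y i) / s i)] with u hu
        rw [div_lt_iff₀ hp] at hu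
        simp only [h, false_imp_iff, iff_true]
        linarith
    filter_upwards [eventually_all.2 this] with u hu
    exact forall_congr' hu
  have h2 : Tendsto (fun u : ℝ => Real.exp (-(∑ i, lam i * y i) - QF B (fun i => Dg I u i * y i) / 2))
      atTop (𝓝 (Real.exp (-(∑ i, lam i * y i) - QF B (fun i => Di I i * y i) / 2))) := by
    have h3 : Tendsto (fun u : ℝ => (fun i => Dg I u i * y i)) atTop
        (𝓝 (fun i => Di I i * y i)) := by
      rw [tendsto_pi_nhds]
      intro i
      refine Tendsto.mul_const _ ?_
      by_cases hi : i ∈ I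
      · simpa [Dg, Di, hi] using tendsto_inv_atTop_zero
      · simp [Dg, Di, hi]
    have h4 := ((QF_cont B).tendsto _).comp h3
    exact (Real.continuous_exp.tendsto _).comp ((h4.div_const 2).const_sub _)
  unfold Kinf
  split_ifs with h
  · refine h2.congr' ?_
    filter_upwards [h1] with u hu
    simp only [KK]
    rw [if_pos (hu.2 h)]
  · refine (tendsto_const_nhds).congr' ?_
    filter_upwards [h1] with u hu
    simp only [KK]
    rw [if_neg (fun h' => h (hu.1 h'))]

lemma fKK_int {ι : Type*} [Fintype ι] [DecidableEq ι] (B : Matrix ι ι ℝ) (I : Finset ι)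
    (lam s : ι → ℝ) (κ : ℝ) (hκ : 0 < κ) (hQ : ∀ x : ι → ℝ, κ * ∑ i, x i ^ 2 ≤ QF B x)
    (hl : ∀ i, i ∉ I → lam i = 0) (hlp : ∀ i ∈ I, 0 < lam i) (hs : ∀ i ∈ I, s i = 0)
    (i0 : ι) (hi0 : i0 ∈ I) (f : ℝ → ℝ) (hfm : Measurable f)
    (hf : Integrable (fun t => f t * ph (lam i0) t)) (u : ℝ) :
    Integrable (fun y : ι → ℝ => f (y i0) * KK B lam s (Dg I u) u y) := by
  refine (dom_int I lam κ hκ hlp i0 hi0 f hf).mono'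
    ((hfm.comp (measurable_pi_apply i0)).mul (KK_meas ..)).aestronglyMeasurable
    (Eventually.of_forall fun y => ?_)
  rw [norm_mul, Real.norm_eq_abs, Real.norm_of_nonneg (KK_nonneg ..)]
  gcongr
  exact KK_le B I lam s _ κ hκ hQ hl (fun i hi => by simp [Dg, hi]) hs u y

lemma fKinf_int {ι : Type*} [Fintype ι] [DecidableEq ι] (B : Matrix ι ι ℝ) (I : Finset ι)
    (lam s : ι → ℝ) (κ : ℝ) (hκ : 0 < κ) (hQ : ∀ x : ι → ℝ, κ * ∑ i, x i ^ 2 ≤ QF B x)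
    (hl : ∀ i, i ∉ I → lam i = 0) (hlp : ∀ i ∈ I, 0 < lam i) (hs : ∀ i ∈ I, s i = 0)
    (i0 : ι) (hi0 : i0 ∈ I) (f : ℝ → ℝ) (hfm : Measurable f)
    (hf : Integrable (fun t => f t * ph (lam i0) t)) :
    Integrable (fun y : ι → ℝ => f (y i0) * Kinf B lam s (Di I) y) := by
  refine (dom_int I lam κ hκ hlp i0 hi0 f hf).mono'
    ((hfm.comp (measurable_pi_apply i0)).mul (Kinf_meas ..)).aestronglyMeasurable
    (Eventually.of_forall fun y => ?_)
  rw [norm_mul, Real.norm_eq_abs, Real.norm_of_nonneg (Kinf_nonneg ..)]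
  gcongr
  exact Kinf_le B I lam s _ κ hκ hQ hl (fun i hi => by simp [Di, hi]) hs y

lemma fKK_tendsto {ι : Type*} [Fintype ι] [DecidableEq ι] (B : Matrix ι ι ℝ) (I : Finset ι)
    (lam s : ι → ℝ) (κ : ℝ) (hκ : 0 < κ) (hQ : ∀ x : ι → ℝ, κ * ∑ i, x i ^ 2 ≤ QF B x)
    (hl : ∀ i, i ∉ I → lam i = 0) (hlp : ∀ i ∈ I, 0 < lam i) (hs : ∀ i ∈ I, s i = 0)
    (hs0 : ∀ i, 0 ≤ s i)
    (i0 : ι) (hi0 : i0 ∈ I) (f : ℝ → ℝ) (hfm : Measurable f)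
    (hf : Integrable (fun t => f t * ph (lam i0) t)) :
    Tendsto (fun u => ∫ y : ι → ℝ, f (y i0) * KK B lam s (Dg I u) u y) atTop
      (𝓝 (∫ y : ι → ℝ, f (y i0) * Kinf B lam s (Di I) y)) := by
  refine tendsto_integral_filter_of_dominated_convergence _
    (Eventually.of_forall fun u => ?_) (Eventually.of_forall fun u => Eventually.of_forall fun y => ?_)
    (dom_int I lam κ hκ hlp i0 hi0 f hf)
    (Eventually.of_forall fun y => (KK_tendsto B I lam s hs0 y).const_mul _)
  · exact (fKK_int B I lam s κ hκ hQ hl hlp hs i0 hi0 f hfm hf u).aestronglyMeasurable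
  · rw [norm_mul, Real.norm_eq_abs, Real.norm_of_nonneg (KK_nonneg ..)]
    gcongr
    exact KK_le B I lam s _ κ hκ hQ hl (fun i hi => by simp [Dg, hi]) hs u y

lemma Kinf_pos {ι : Type*} [Fintype ι] (B : Matrix ι ι ℝ) (lam s e : ι → ℝ)
    (hi : Integrable (Kinf B lam s e)) : 0 < ∫ y, Kinf B lam s e y := by
  rw [integral_pos_iff_support_of_nonneg (fun y => Kinf_nonneg ..) hi]
  have ho : IsOpen (Set.univ.pi fun _ : ι => Set.Ioi (0 : ℝ)) :=
    isOpen_set_pi Set.finite_univ fun _ _ => isOpen_Ioi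
  refine lt_of_lt_of_le (ho.measure_pos volume ⟨fun _ => 1, by simp⟩) (measure_mono fun y hy => ?_)
  simp only [Set.mem_pi, Set.mem_univ, true_imp_iff, Set.mem_Ioi] at hy
  simp only [Function.mem_support, Kinf]
  rw [if_pos fun i _ => hy i]
  exact (Real.exp_pos _).ne'

open Classical in
lemma Kinf_fact {n : ℕ} (B : Matrix (Fin (n+1)) (Fin (n+1)) ℝ) (lam s e : Fin (n+1) → ℝ)
    (hs : s 0 = 0) (he : e 0 = 0) : ∃ G : (Fin n → ℝ) → ℝ, ∀ f : ℝ → ℝ,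
    ∫ y : Fin (n+1) → ℝ, f (y 0) * Kinf B lam s e y = (∫ t, f t * ph (lam 0) t) * ∫ z, G z := by
  refine ⟨fun z => if (∀ i : Fin n, s i.succ = 0 → 0 < z i) then
    Real.exp (-(∑ i : Fin n, lam i.succ * z i) - QF B (fun i => e i * (Fin.cons 0 z : Fin (n+1) → ℝ) i) / 2)
    else 0, fun f => ?_⟩
  have hp := (volume_preserving_piFinSuccAbove (fun _ : Fin (n+1) => ℝ) 0).symm
  rw [← hp.integral_comp (MeasurableEquiv.measurableEmbedding _), ← integral_prod_mul]
  refine integral_congr_ae (Eventually.of_forall fun p => ?_)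
  obtain ⟨t, z⟩ := p
  have hy : (MeasurableEquiv.piFinSuccAbove (fun _ : Fin (n+1) => ℝ) 0).symm (t, z) = Fin.cons t z := by
    simp [MeasurableEquiv.piFinSuccAbove, Fin.insertNthEquiv]
  simp only [hy, Fin.cons_zero]
  rw [mul_assoc]
  congr 1
  have hE : (fun i => e i * (Fin.cons t z : Fin (n+1) → ℝ) i) =
      (fun i => e i * (Fin.cons 0 z : Fin (n+1) → ℝ) i) := by
    ext i; refine Fin.cases ?_ (fun j => ?_) i <;> simp [he]
  unfold Kinf ph
  rw [hE]
  simp only [Fin.forall_fin_succ, hs, true_imp_iff, Fin.cons_zero, Fin.cons_succ, Fin.sum_univ_succ]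
  by_cases h1 : 0 < t <;> by_cases h2 : (∀ i : Fin n, s i.succ = 0 → 0 < z i)
  · rw [if_pos ⟨h1, h2⟩, if_pos h1, if_pos h2, ← Real.exp_add]
    congr 1; ring
  all_goals simp [h1, h2]


lemma ratio_lim {d : ℕ} [NeZero d] (B : Matrix (Fin d) (Fin d) ℝ) (hB : B.PosDef)
    (I : Finset (Fin d)) (lam s : Fin d → ℝ)
    (hl : ∀ i, i ∉ I → lam i = 0) (hlp : ∀ i ∈ I, 0 < lam i) (hs : ∀ i ∈ I, s i = 0)
    (hs0 : ∀ i, 0 ≤ s i) (h0 : (0 : Fin d) ∈ I) :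
    (∀ u, Integrable (fun y : Fin d → ℝ => KK B lam s (Dg I u) u y)) ∧
    (∀ u, Integrable (fun y : Fin d → ℝ => y 0 * KK B lam s (Dg I u) u y)) ∧
    (∀ᶠ u in atTop, (∫ y : Fin d → ℝ, KK B lam s (Dg I u) u y) ≠ 0) ∧
    Tendsto (fun u => (∫ y : Fin d → ℝ, y 0 * KK B lam s (Dg I u) u y) /
      ∫ y : Fin d → ℝ, KK B lam s (Dg I u) u y) atTop (𝓝 (1 / lam 0)) := by
  obtain ⟨κ, hκ, hQ⟩ := QF_lower B hB
  have l0 := hlp 0 h0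
  have m0 : Measurable (fun _ : ℝ => (1 : ℝ)) := measurable_const
  have m1 : Measurable (fun t : ℝ => t) := measurable_id
  have T0 := fKK_tendsto B I lam s κ hκ hQ hl hlp hs hs0 0 h0 _ m0 (ph_int0 l0)
  have T1 := fKK_tendsto B I lam s κ hκ hQ hl hlp hs hs0 0 h0 _ m1 (ph_int1 l0)
  have J0 := fun u => fKK_int B I lam s κ hκ hQ hl hlp hs 0 h0 _ m0 (ph_int0 l0) u
  have J1 := fun u => fKK_int B I lam s κ hκ hQ hl hlp hs 0 h0 _ m1 (ph_int1 l0) u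
  have Ji := fKinf_int B I lam s κ hκ hQ hl hlp hs 0 h0 _ m0 (ph_int0 l0)
  simp only [one_mul] at T0 J0 Ji
  have hpos := Kinf_pos B lam s (Di I) Ji
  have hval : ∫ y : Fin d → ℝ, y 0 * Kinf B lam s (Di I) y =
      (1 / lam 0) * ∫ y : Fin d → ℝ, Kinf B lam s (Di I) y := by
    obtain ⟨n, rfl⟩ : ∃ n, d = n + 1 := ⟨d - 1, by have := NeZero.pos d; omega⟩
    obtain ⟨G, hG⟩ := Kinf_fact B lam s (Di I) (hs _ h0) (by simpa [Di] using! h0)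
    have e0 := hG (fun _ => 1)
    have e1 := hG (fun t => t)
    rw [ph_val0 l0] at e0
    rw [ph_val1 l0] at e1
    simp only [one_mul] at e0
    refine e1.trans ?_
    rw [e0]; ring
  refine ⟨J0, J1, T0.eventually_ne hpos.ne', ?_⟩
  have := T1.div T0 hpos.ne'
  rw [hval, mul_div_assoc, div_self hpos.ne', mul_one] at this
  exact this

lemma QF_add {ι : Type*} [Fintype ι] (B : Matrix ι ι ℝ) (hB : Bᵀ = B) (a b : ι → ℝ) :
    QF B (a + b) = QF B a + 2 * (b ⬝ᵥ B.mulVec a) + QF B b := by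
  have : a ⬝ᵥ B.mulVec b = b ⬝ᵥ B.mulVec a := by
    rw [Matrix.dotProduct_mulVec, ← Matrix.mulVec_transpose, hB, dotProduct_comm]
  simp only [QF, Matrix.mulVec_add, dotProduct_add, add_dotProduct, this]
  ring

lemma prob_side {Ω ι : Type*} [MeasurableSpace Ω] [Fintype ι] [DecidableEq ι] (P : Measure Ω)
    (A : Matrix ι ι ℝ) (hA : A.PosDef) (X : Ω → ι → ℝ) (hX : Measurable X)
    (hG : IsCenteredGaussianRV P X A) (c bt lam s : ι → ℝ) (I : Finset ι)
    (hl : ∀ i, i ∉ I → lam i = 0) (hs : ∀ i, s i = bt i - c i) (hsI : ∀ i ∈ I, s i = 0)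
    (hlam : A⁻¹.mulVec bt = lam) (u : ℝ) (hu : 0 < u) :
    ∃ C : ℝ, C ≠ 0 ∧ ∀ f : (ι → ℝ) → ℝ, Measurable f →
      ∫ ω in {ω | ∀ i, c i * u < X ω i}, f (X ω) ∂P =
        C * ∫ y : ι → ℝ, f (fun i => u * bt i + Dg I u i * y i) * KK A⁻¹ lam s (Dg I u) u y := by
  have hsym : (A⁻¹)ᵀ = A⁻¹ := by
    have := hA.inv.isHermitian
    simpa [Matrix.IsHermitian] using this
  have hD : ∀ i, Dg I u i ≠ 0 := by
    intro i; unfold Dg; split_ifs <;> simp [hu.ne']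
  have hDp : ∀ i, 0 < Dg I u i := by
    intro i; unfold Dg; split_ifs <;> simp [hu]
  have hprod : |∏ i, Dg I u i| ≠ 0 := abs_ne_zero.2 (Finset.prod_ne_zero_iff.2 fun i _ => hD i)
  have hC0 : (Real.sqrt ((2 * Real.pi) ^ Fintype.card ι * A.det))⁻¹ ≠ 0 := by
    have := hA.det_pos
    have := Real.pi_pos
    positivity
  have hpdfm : Measurable (gaussPDF A) := by
    have := (QF_cont A⁻¹).measurable
    unfold QF at this
    unfold gaussPDF
    fun_prop
  have hpdf0 : ∀ x, 0 ≤ gaussPDF A x := fun x => by unfold gaussPDF; positivity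
  refine ⟨|∏ i, Dg I u i| * ((Real.sqrt ((2 * Real.pi) ^ Fintype.card ι * A.det))⁻¹ *
    Real.exp (-(u ^ 2 * QF A⁻¹ bt) / 2)), mul_ne_zero hprod (mul_ne_zero hC0 (Real.exp_ne_zero _)),
    fun f hf => ?_⟩
  set S : Set (ι → ℝ) := {x | ∀ i, c i * u < x i} with hS
  have hSm : MeasurableSet S := by
    rw [hS, Set.ofPred_forall]
    exact MeasurableSet.iInter fun i => measurableSet_lt measurable_const (measurable_pi_apply i)
  have e1 : ∫ ω in {ω | ∀ i, c i * u < X ω i}, f (X ω) ∂P =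
      ∫ x, S.indicator (fun x => gaussPDF A x * f x) x := by
    have := setIntegral_map (μ := P) hSm hf.aestronglyMeasurable hX.aemeasurable
    rw [integral_indicator hSm]
    refine this.symm.trans ?_
    rw [hG, setIntegral_withDensity_eq_setIntegral_toReal_smul (by fun_prop) (by simp) _ hSm]
    simp [ENNReal.toReal_ofReal (hpdf0 _)]
  rw [e1, cov_diag (Dg I u) hD (fun i => u * bt i)
      (S.indicator (fun x => gaussPDF A x * f x)) ((hpdfm.mul hf).indicator hSm), mul_assoc]
  congr 1
  rw [← integral_const_mul]
  congr 1
  funext y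
  have hiff : (fun i => u * bt i + Dg I u i * y i) ∈ S ↔ ∀ i, -(s i) * u < y i := by
    simp only [hS, Set.mem_setOf_eq]
    refine forall_congr' fun i => ?_
    by_cases hi : i ∈ I
    · have h1 := hsI i hi
      have h2 : bt i = c i := by have := hs i; linarith
      rw [h1, h2, mul_comm u]
      simp [mul_pos_iff_of_pos_left (hDp i)]
    · rw [hs i]
      simp only [Dg, hi, if_false]
      constructor <;> intro h <;> linarith
  by_cases h : (fun i => u * bt i + Dg I u i * y i) ∈ S
  · rw [Set.indicator_of_mem h]
    simp only [KK]
    rw [if_pos (hiff.1 h)]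
    unfold gaussPDF
    have hq := QF_add A⁻¹ hsym (u • bt) (fun i => Dg I u i * y i)
    have hx : (fun i => u * bt i + Dg I u i * y i) = u • bt + (fun i => Dg I u i * y i) := by
      ext i; simp
    have hcross : (fun i => Dg I u i * y i) ⬝ᵥ A⁻¹.mulVec (u • bt) = ∑ i, lam i * y i := by
      rw [Matrix.mulVec_smul, hlam]
      simp only [dotProduct, Pi.smul_apply, smul_eq_mul]
      refine Finset.sum_congr rfl fun i _ => ?_
      by_cases hi : i ∈ I
      · simp only [Dg, hi, if_true]; field_simp
      · simp [hl i hi]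
    rw [hcross, QF_smul] at hq
    rw [← hx] at hq
    have he : Real.exp (-((fun i => u * bt i + Dg I u i * y i) ⬝ᵥ
        A⁻¹.mulVec (fun i => u * bt i + Dg I u i * y i)) / 2) =
        Real.exp (-(u ^ 2 * QF A⁻¹ bt) / 2) *
        Real.exp (-(∑ i, lam i * y i) - QF A⁻¹ (fun i => Dg I u i * y i) / 2) := by
      rw [← Real.exp_add]
      congr 1
      change -(QF A⁻¹ _) / 2 = _
      rw [hq]; ring
    rw [he]; ring
  · rw [Set.indicator_of_notMem h]
    simp only [KK]
    rw [if_neg (fun h' => h (hiff.2 h'))]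
    ring

/-- MCTE approximation, case `1 ∈ I`: `lim_{u→∞} u[M(c,u) - c_1 u] = 1/(c_I^⊤(Σ_II)⁻¹e_1) > 0`. -/
theorem mcte_multivariate_gaussian_case_i
    {Ω : Type*} [MeasurableSpace Ω] (P : Measure Ω) [IsProbabilityMeasure P]
    {d : ℕ} [NeZero d] (A : Matrix (Fin d) (Fin d) ℝ) (hA : A.PosDef)
    (hcorr : ∀ i, A i i = 1)
    (X : Ω → Fin d → ℝ) (hX : Measurable X) (hG : IsCenteredGaussianRV P X A)
    (c : Fin d → ℝ) (hc : ∃ i, 0 < c i)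
    (bt : Fin d → ℝ) (I : Finset (Fin d))
    (hsol : IsQPSol A c bt) (hI : IsQPIndex A c bt I)
    (h1I : (0 : Fin d) ∈ I) :
    Tendsto (fun u => u * (mcteV P X c u - c 0 * u)) atTop (𝓝 (1 / eDot A c I 0)) ∧
    0 < 1 / eDot A c I 0 := by
    classical
  obtain ⟨hne, hbt, hw, hj⟩ := hI
  set w := (subM A I I)⁻¹.mulVec (subV c I) with hwdef
  have hAI : (subM A I I).PosDef := hA.submatrix (e := ((↑) : ↥I → Fin d)) Subtype.val_injective
  have hAIu : IsUnit (subM A I I).det := hAI.det_pos.ne'.isUnit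
  have hAu : IsUnit A.det := hA.det_pos.ne'.isUnit
  have hAw : (subM A I I).mulVec w = subV c I := by
    rw [hwdef, Matrix.mulVec_mulVec, Matrix.mul_nonsing_inv _ hAIu, Matrix.one_mulVec]
  have hlamex : ∃ lam : Fin d → ℝ, ∀ i, lam i = if h : i ∈ I then w ⟨i, h⟩ else 0 := ⟨_, fun _ => rfl⟩
  obtain ⟨lam, hlam⟩ := hlamex
  have hl : ∀ i, i ∉ I → lam i = 0 := fun i hi => by rw [hlam]; simp [hi]
  have hlI : ∀ i : ↥I, lam i = w i := fun i => by rw [hlam]; simp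
  have hlp : ∀ i ∈ I, 0 < lam i := fun i hi => by rw [hlI ⟨i, hi⟩]; exact hw _
  have hsum : ∀ i, A.mulVec lam i = (fun j : ↥I => A i j) ⬝ᵥ w := by
    intro i
    simp only [Matrix.mulVec, dotProduct]
    rw [← Finset.sum_subset (Finset.subset_univ I) (fun j _ hj => by rw [hl j hj, mul_zero]),
      ← Finset.sum_coe_sort]
    exact Finset.sum_congr rfl fun j _ => by rw [hlI]
  have hAl : A.mulVec lam = bt := by
    ext i
    rw [hsum]
    by_cases hi : i ∈ I
    · rw [hbt i hi]
      exact congrFun hAw ⟨i, hi⟩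
    · exact (hj i hi).symm
  have hBl : A⁻¹.mulVec bt = lam := by
    rw [← hAl, Matrix.mulVec_mulVec, Matrix.nonsing_inv_mul _ hAu, Matrix.one_mulVec]
  have heD : eDot A c I 0 = lam 0 := by
    have hsym : ((subM A I I)⁻¹)ᵀ = (subM A I I)⁻¹ := by
      have := hAI.inv.isHermitian
      simpa [Matrix.IsHermitian] using this
    unfold eDot
    rw [Matrix.dotProduct_mulVec, ← Matrix.mulVec_transpose, hsym, ← hwdef]
    have : (fun j : ↥I => if (j : Fin d) = 0 then (1 : ℝ) else 0) = Pi.single ⟨0, h1I⟩ 1 := by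
      ext j
      simp [Pi.single_apply, Subtype.ext_iff]
    rw [this, dotProduct_single, mul_one]
    exact (hlI ⟨0, h1I⟩).symm
  rw [heD]
  refine ⟨?_, one_div_pos.2 (hlp 0 h1I)⟩
  have hsI : ∀ i ∈ I, (fun i => bt i - c i) i = 0 := fun i hi => by simp [hbt i hi]
  obtain ⟨J0, J1, hne0, hT⟩ := ratio_lim A⁻¹ hA.inv I lam (fun i => bt i - c i) hl hlp hsI
    (fun i => sub_nonneg.2 (hsol.1 i)) h1I
  refine hT.congr' ?_
  filter_upwards [hne0, eventually_gt_atTop 0] with u hDu hu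
  obtain ⟨C, hC, hf⟩ := prob_side P A hA X hX hG c bt lam (fun i => bt i - c i) I hl
    (fun _ => rfl) hsI hBl u hu
  have e0 := hf (fun _ => 1) measurable_const
  have e1 := hf (fun x => x 0) (measurable_pi_apply 0)
  have hP : (P {ω | ∀ i, c i * u < X ω i}).toReal =
      ∫ ω in {ω | ∀ i, c i * u < X ω i}, (fun _ => (1 : ℝ)) (X ω) ∂P := by
    simp [Measure.real]
  unfold mcteV
  rw [hP, e0, e1]
  simp only [one_mul]
  have hint : ∫ y : Fin d → ℝ, (u * bt 0 + Dg I u 0 * y 0) *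
        KK A⁻¹ lam (fun i => bt i - c i) (Dg I u) u y =
      u * c 0 * (∫ y, KK A⁻¹ lam (fun i => bt i - c i) (Dg I u) u y) +
      u⁻¹ * ∫ y : Fin d → ℝ, y 0 * KK A⁻¹ lam (fun i => bt i - c i) (Dg I u) u y := by
    rw [← integral_const_mul, ← integral_const_mul,
      ← integral_add ((J0 u).const_mul _) ((J1 u).const_mul _)]
    congr 1
    funext y
    rw [hbt 0 h1I]
    simp only [Dg, h1I, if_true]
    ring
  rw [hint]
  field_simp
  ring
end
end
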